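/- Let H be a finite-dimensional Hopf algebra over a field k of characteristic zero with the Chevalley property (Jacobson radical J is a Hopf ideal), and let π : H → H/J be the quotient Hopf algebra map. Then π(p) = p_{H/J}, where p = (1/dim H)χ_{H*} and p_{H/J} = (1/dim(H/J))χ_{(H/J)*}; in particular π(p) is the Haar integral of the semisimple Hopf algebra H/J. -/

import Mathlib

open TensorProduct

/-- The convolution product on the dual `H* = Hom_k(H, k)` of a `k`-coalgebra `H`:
`(f ⋆ g) h = f h₍₁₎ * g h₍₂₎`.  This is the multiplication of the dual algebra `H*`. -/
noncomputable def convMul (k H : Type*) [CommRing k] [AddCommGroup H] [Module k H]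
    [Coalgebra k H] :
    Module.Dual k H →ₗ[k] Module.Dual k H →ₗ[k] Module.Dual k H :=
  TensorProduct.curry
    ((Coalgebra.comul (R := k) (A := H)).dualMap ∘ₗ TensorProduct.dualDistrib k H H)

/-- The element `p = (1/dim H) χ_{H*} ∈ H`: the character of the regular representation
of the dual Hopf algebra `H*`, viewed as an element of `H ≅ H**` and normalized by
`1/dim H`. -/
noncomputable def pIdem (k H : Type*) [Field k] [Ring H] [HopfAlgebra k H]
    [FiniteDimensional k H] : H :=
  (Module.finrank k H : k)⁻¹ •
    (Module.evalEquiv k H).symm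
      ((LinearMap.trace k (Module.Dual k H)) ∘ₗ convMul k H)

open TensorProduct

namespace St15

section Basics

variable {k H : Type*} [Field k] [Ring H] [HopfAlgebra k H]

/-- slice on the left factor: `a ⊗ b ↦ f a • b` -/
noncomputable def slL (f : H →ₗ[k] k) : H ⊗[k] H →ₗ[k] H :=
  (TensorProduct.lid k H).toLinearMap ∘ₗ f.rTensor H

/-- slice on the right factor: `a ⊗ b ↦ f b • a` -/
noncomputable def slR (f : H →ₗ[k] k) : H ⊗[k] H →ₗ[k] H :=
  (TensorProduct.rid k H).toLinearMap ∘ₗ f.lTensor H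

@[simp] lemma slL_tmul (f : H →ₗ[k] k) (a b : H) : slL f (a ⊗ₜ b) = f a • b := by
  simp [slL]

@[simp] lemma slR_tmul (f : H →ₗ[k] k) (a b : H) : slR f (a ⊗ₜ b) = f b • a := by
  simp [slR]

/-- `h ↦ f h₁ • h₂` -/
noncomputable def RR (f : H →ₗ[k] k) : H →ₗ[k] H := slL f ∘ₗ Coalgebra.comul

/-- `h ↦ f h₂ • h₁` -/
noncomputable def LL (f : H →ₗ[k] k) : H →ₗ[k] H := slR f ∘ₗ Coalgebra.comul

lemma RR_apply (f : H →ₗ[k] k) (x : H) : RR f x = slL f (Coalgebra.comul x) := rfl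
lemma LL_apply (f : H →ₗ[k] k) (x : H) : LL f x = slR f (Coalgebra.comul x) := rfl

@[simp] lemma RR_one (f : H →ₗ[k] k) : RR f (1 : H) = f 1 • (1 : H) := by
  simp [RR_apply, Algebra.TensorProduct.one_def]

lemma slL_mul_right (f : H →ₗ[k] k) (t : H ⊗[k] H) (c : H) :
    slL f (t * ((1 : H) ⊗ₜ[k] c)) = slL f t * c := by
  induction t with
  | zero => simp
  | tmul a b => simp
  | add a b ha hb => simp [add_mul, ha, hb]

lemma slL_mul_left (f : H →ₗ[k] k) (t : H ⊗[k] H) (c : H) :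
    slL f (((1 : H) ⊗ₜ[k] c) * t) = c * slL f t := by
  induction t with
  | zero => simp
  | tmul a b => simp
  | add a b ha hb => simp [mul_add, ha, hb]

lemma apply_slL (f g : H →ₗ[k] k) (t : H ⊗[k] H) : g (slL f t) = f (slR g t) := by
  induction t with
  | zero => simp
  | tmul a b => simp [mul_comm]
  | add a b ha hb => simp [ha, hb]

lemma apply_RR (f g : H →ₗ[k] k) (x : H) : g (RR f x) = f (LL g x) := apply_slL _ _ _

lemma counit_RR (f : H →ₗ[k] k) (x : H) : Coalgebra.counit (R := k) (RR f x) = f x := by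
  rw [apply_RR, LL_apply, slR]
  simp

lemma LL_counit (x : H) : LL (Coalgebra.counit (R := k)) x = x := by
  rw [LL_apply, slR]
  simp

lemma RR_counit (x : H) : RR (Coalgebra.counit (R := k)) x = x := by
  rw [RR_apply, slL]
  simp

/-- coassociativity: `Δ ∘ LL f = (id ⊗ LL f) ∘ Δ` -/
lemma comul_LL (f : H →ₗ[k] k) (x : H) :
    Coalgebra.comul (R := k) (LL f x) = (LL f).lTensor H (Coalgebra.comul x) := by
  have h1 : ∀ t : H ⊗[k] H, Coalgebra.comul (R := k) (slR f t) =
      (slR f).lTensor H (TensorProduct.assoc k H H H (Coalgebra.comul.rTensor H t)) := by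
    intro t
    induction t with
    | zero => simp
    | add a b ha hb => simp [ha, hb]
    | tmul a b =>
      simp only [slR_tmul, map_smul, LinearMap.rTensor_tmul]
      generalize (Coalgebra.comul (R := k) a) = s
      induction s with
      | zero => simp
      | add a b ha hb => simp [ha, hb, TensorProduct.add_tmul]
      | tmul a b => simp
  rw [LL_apply, h1, Coalgebra.coassoc_apply]
  rw [LL, LinearMap.lTensor_comp]
  rfl

lemma comul_RR (f : H →ₗ[k] k) (x : H) :
    Coalgebra.comul (R := k) (RR f x) = (RR f).rTensor H (Coalgebra.comul x) := by
  have h1 : ∀ t : H ⊗[k] H, Coalgebra.comul (R := k) (slL f t) =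
      (slL f).rTensor H ((TensorProduct.assoc k H H H).symm (Coalgebra.comul.lTensor H t)) := by
    intro t
    induction t with
    | zero => simp
    | add a b ha hb => simp [ha, hb]
    | tmul a b =>
      simp only [slL_tmul, map_smul, LinearMap.lTensor_tmul]
      generalize (Coalgebra.comul (R := k) b) = s
      induction s with
      | zero => simp
      | add a b ha hb => simp [ha, hb, TensorProduct.tmul_add]
      | tmul a b => simp [TensorProduct.smul_tmul']
  rw [RR_apply, h1, Coalgebra.coassoc_symm_apply]
  rw [RR, LinearMap.rTensor_comp]
  rfl

lemma slL_rTensor (f : H →ₗ[k] k) (F : H →ₗ[k] H) (t : H ⊗[k] H) :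
    slL f (F.rTensor H t) = slL (f ∘ₗ F) t := by
  induction t with
  | zero => simp
  | tmul a b => simp
  | add a b ha hb => simp [ha, hb]

lemma RR_comp (f g : H →ₗ[k] k) (x : H) : RR (g ∘ₗ RR f) x = RR g (RR f x) := by
  rw [RR_apply, RR_apply g, comul_RR, slL_rTensor]

/-- two linear functionals detect elements -/
lemma eq_of_dual {x y : H} (h : ∀ f : H →ₗ[k] k, f x = f y) : x = y := by
  rw [← sub_eq_zero]
  refine (Module.forall_dual_apply_eq_zero_iff k _).mp fun f => ?_
  rw [map_sub, h f, sub_self]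

open HopfAlgebra in
/-- `∑ (S h₁ ⊗ 1) Δ h₂ = 1 ⊗ h` -/
lemma sum_D1 {ι : Type*} (h : H) (r : Coalgebra.Repr k h ι) :
    ∑ i ∈ r.index, ((antipode k (r.left i)) ⊗ₜ[k] (1 : H)) * Coalgebra.comul (r.right i)
      = (1 : H) ⊗ₜ[k] h := by
  have h1 : ∀ a b : H, ((antipode k a) ⊗ₜ[k] (1 : H)) * Coalgebra.comul b =
      (LinearMap.mul' k H ∘ₗ (antipode k).rTensor H).rTensor H
        ((TensorProduct.assoc k H H H).symm (Coalgebra.comul.lTensor H (a ⊗ₜ[k] b))) := by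
    intro a b
    simp only [LinearMap.lTensor_tmul]
    generalize (Coalgebra.comul (R := k) b) = s
    induction s with
    | zero => simp
    | add a b ha hb => simp [ha, hb, TensorProduct.tmul_add, mul_add]
    | tmul a b => simp
  simp_rw [h1]
  rw [← map_sum, ← map_sum, ← map_sum, r.eq, Coalgebra.coassoc_symm_apply,
    ← LinearMap.rTensor_comp_apply, LinearMap.comp_assoc, mul_antipode_rTensor_comul,
    LinearMap.rTensor_comp_apply, Coalgebra.rTensor_counit_comul]
  simp

open HopfAlgebra in
/-- `∑ Δ h₁ (1 ⊗ S h₂) = h ⊗ 1` -/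
lemma sum_D2 {ι : Type*} (h : H) (r : Coalgebra.Repr k h ι) :
    ∑ i ∈ r.index, Coalgebra.comul (r.left i) * ((1 : H) ⊗ₜ[k] (antipode k (r.right i)))
      = h ⊗ₜ[k] (1 : H) := by
  have h1 : ∀ a b : H, Coalgebra.comul a * ((1 : H) ⊗ₜ[k] (antipode k b)) =
      (LinearMap.mul' k H ∘ₗ (antipode k).lTensor H).lTensor H
        ((TensorProduct.assoc k H H H) (Coalgebra.comul.rTensor H (a ⊗ₜ[k] b))) := by
    intro a b
    simp only [LinearMap.rTensor_tmul]
    generalize (Coalgebra.comul (R := k) a) = s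
    induction s with
    | zero => simp
    | add a b ha hb => simp [ha, hb, TensorProduct.add_tmul, add_mul]
    | tmul a b => simp
  simp_rw [h1]
  rw [← map_sum, ← map_sum, ← map_sum, r.eq, Coalgebra.coassoc_apply,
    ← LinearMap.lTensor_comp_apply, LinearMap.comp_assoc, mul_antipode_lTensor_comul,
    LinearMap.lTensor_comp_apply, Coalgebra.lTensor_counit_comul]
  simp

open HopfAlgebra WithConv in
lemma comul_antipode_aux (c : H) :
    LinearMap.mul' k (H ⊗[k] H) (TensorProduct.map (TensorProduct.map (antipode k) (antipode k) ∘ₗ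
      (TensorProduct.comm k H H).toLinearMap ∘ₗ (Coalgebra.comul (R := k) (A := H)))
      (Coalgebra.comul (R := k) (A := H)) (Coalgebra.comul c)) =
      algebraMap k (H ⊗[k] H) (Coalgebra.counit c) := by
  let A1 : H ⊗[k] H →ₗ[k] H ⊗[k] H := LinearMap.mul' k (H ⊗[k] H) ∘ₗ
    TensorProduct.map ((TensorProduct.mk k H H).flip 1 ∘ₗ antipode k) Coalgebra.comul
  have hA1 : ∀ b : H, A1 (Coalgebra.comul b) = (1 : H) ⊗ₜ[k] b := by
    intro b
    have r := Coalgebra.Repr.arbitrary k b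
    rw [← sum_D1 b r]
    conv_lhs => rw [← r.eq]
    simp [A1]
  let V : H ⊗[k] (H ⊗[k] H) →ₗ[k] H ⊗[k] H := LinearMap.mul' k (H ⊗[k] H) ∘ₗ
    TensorProduct.map (TensorProduct.mk k H H 1 ∘ₗ antipode k) A1
  have h1 : ∀ t : H ⊗[k] H, LinearMap.mul' k (H ⊗[k] H) (TensorProduct.map
      (TensorProduct.map (antipode k) (antipode k) ∘ₗ
      (TensorProduct.comm k H H).toLinearMap ∘ₗ (Coalgebra.comul (R := k) (A := H)))
      (Coalgebra.comul (R := k) (A := H)) t) =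
      V (TensorProduct.assoc k H H H (Coalgebra.comul.rTensor H t)) := by
    intro t
    induction t with
    | zero => simp
    | add a b ha hb => simp only [map_add, ha, hb]
    | tmul a b =>
      simp only [TensorProduct.map_tmul, LinearMap.rTensor_tmul, LinearMap.comp_apply]
      generalize (Coalgebra.comul (R := k) a) = s
      induction s with
      | zero => simp
      | add a b ha hb =>
        simp only [map_add, TensorProduct.add_tmul] at ha hb ⊢
        rw [ha, hb]
      | tmul a b => simp [V, A1, ← mul_assoc]
  rw [h1, Coalgebra.coassoc_apply]
  have h2 : ∀ t : H ⊗[k] H, V (Coalgebra.comul.lTensor H t) =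
      (1 : H) ⊗ₜ[k] (LinearMap.mul' k H ((antipode k).rTensor H t)) := by
    intro t
    induction t with
    | zero => simp
    | add a b ha hb => simp only [map_add, ha, hb, TensorProduct.tmul_add]
    | tmul a b => simp [V, hA1]
  rw [h2, mul_antipode_rTensor_comul_apply, Algebra.TensorProduct.algebraMap_apply,
    Algebra.algebraMap_eq_smul_one, TensorProduct.tmul_smul, TensorProduct.smul_tmul']

open HopfAlgebra WithConv in
lemma comul_antipode (h : H) : Coalgebra.comul (R := k) (antipode k h) =
    TensorProduct.map (antipode k) (antipode k)
      (TensorProduct.comm k H H (Coalgebra.comul h)) := by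
  have key : toConv (TensorProduct.map (antipode k) (antipode k) ∘ₗ
      (TensorProduct.comm k H H).toLinearMap ∘ₗ (Coalgebra.comul (R := k) (A := H))) =
      toConv (Coalgebra.comul (R := k) (A := H) ∘ₗ antipode k) := by
    apply left_inv_eq_right_inv (a := toConv (Coalgebra.comul (R := k) (A := H)))
    · ext c
      exact comul_antipode_aux c
    · exact LinearMap.comul_right_inv
  have := congrArg (fun z => z.ofConv h) key
  exact this.symm

end Basics
end St15
namespace St15

section Integrals

open HopfAlgebra

variable {k H : Type*} [Field k] [Ring H] [HopfAlgebra k H]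

lemma dagger (Λ : H) (hΛ : ∀ h : H, h * Λ = Coalgebra.counit (R := k) h • Λ) (h : H) :
    ((antipode k h) ⊗ₜ[k] (1 : H)) * Coalgebra.comul Λ =
      ((1 : H) ⊗ₜ[k] h) * Coalgebra.comul (R := k) Λ := by
  have r := Coalgebra.Repr.arbitrary k h
  rw [← sum_D1 h r, Finset.sum_mul]
  simp_rw [mul_assoc, ← Bialgebra.comul_mul, hΛ, map_smul]
  have h2 : h = ∑ i ∈ r.index, Coalgebra.counit (R := k) (r.right i) • r.left i := by
    conv_lhs => rw [← LL_counit (k := k) h, LL_apply, ← r.eq, map_sum]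
    simp only [slR_tmul]
  conv_lhs => rw [h2]
  simp only [map_sum, map_smul, TensorProduct.sum_tmul, Finset.sum_mul]
  refine Finset.sum_congr rfl fun i _ => ?_
  rw [← TensorProduct.smul_tmul', smul_mul_assoc, mul_smul_comm]

variable (k H) in
/-- the functional `x ↦ Tr (z ↦ S² z * x)` -/
noncomputable def lam : H →ₗ[k] k :=
  LinearMap.trace k H ∘ₗ LinearMap.lcomp k H (antipode k ∘ₗ antipode k) ∘ₗ (LinearMap.mul k H).flip

lemma lam_apply (x : H) : lam k H x =
    LinearMap.trace k H (LinearMap.mulRight k x ∘ₗ antipode k ∘ₗ antipode k) := rfl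

lemma lam_cyc (x y : H) : lam k H (x * y) = lam k H (antipode k (antipode k y) * x) := by
  have h1 : LinearMap.mulRight k (x * y) ∘ₗ antipode k ∘ₗ antipode k =
      LinearMap.mulRight k y * (LinearMap.mulRight k x ∘ₗ antipode k ∘ₗ antipode k) := by
    ext z; simp [mul_assoc]
  have h2 : LinearMap.mulRight k (antipode k (antipode k y) * x) ∘ₗ antipode k ∘ₗ antipode k =
      (LinearMap.mulRight k x ∘ₗ antipode k ∘ₗ antipode k) * LinearMap.mulRight k y := by
    ext z; simp [mul_assoc, antipode_mul_antidistrib]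
  rw [lam_apply, h1, LinearMap.trace_mul_comm, ← h2, lam_apply]

lemma sum_antipode_slL {ι : Type*} [Fintype ι] (b : Module.Basis ι k H) (t : H ⊗[k] H) :
    ∑ i, antipode k (b i) * slL (b.coord i) t = LinearMap.mul' k H ((antipode k).rTensor H t) := by
  induction t with
  | zero => simp
  | add x y hx hy => simp only [map_add, mul_add, Finset.sum_add_distrib, hx, hy]
  | tmul x y =>
    simp only [slL_tmul, LinearMap.rTensor_tmul, LinearMap.mul'_apply, mul_smul_comm]
    have hx : antipode k x = ∑ i, b.repr x i • antipode k (b i) := by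
      conv_lhs => rw [← b.sum_repr x]
      rw [map_sum]
      simp_rw [map_smul]
    rw [hx, Finset.sum_mul]
    simp only [smul_mul_assoc, Module.Basis.coord_apply]

variable [FiniteDimensional k H]

lemma lam_eq_sum {ι : Type*} [Fintype ι] (b : Module.Basis ι k H) (x : H) :
    lam k H x = ∑ i, b.coord i (antipode k (antipode k (b i)) * x) := by
  classical
  rw [lam_apply, LinearMap.trace_eq_matrix_trace k b, Matrix.trace]
  simp [LinearMap.toMatrix_apply]

lemma slL_lam {ι : Type*} [Fintype ι] (b : Module.Basis ι k H) (t : H ⊗[k] H) :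
    slL (lam k H) t =
      ∑ i, slL (b.coord i) ((antipode k (antipode k (b i)) ⊗ₜ[k] (1 : H)) * t) := by
  induction t with
  | zero => simp
  | add x y hx hy => simp only [map_add, mul_add, Finset.sum_add_distrib, hx, hy]
  | tmul x y => simp [lam_eq_sum b, Finset.sum_smul]

variable {Λ : H} (hΛ : ∀ h : H, h * Λ = Coalgebra.counit (R := k) h • Λ)
  (hε : Coalgebra.counit (R := k) Λ = 1)

include hΛ hε in
lemma RR_lam_Λ : RR (lam k H) Λ = 1 := by
  let b := Module.finBasis k H
  rw [RR_apply, slL_lam b]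
  simp_rw [dagger Λ hΛ, slL_mul_left]
  rw [sum_antipode_slL, mul_antipode_rTensor_comul_apply, hε, map_one]

include hΛ hε in
lemma RR_lam_mul (y : H) :
    RR (lam k H ∘ₗ LinearMap.mulLeft k (antipode k y)) Λ = y := by
  have h1 : ∀ t : H ⊗[k] H, slL (lam k H ∘ₗ LinearMap.mulLeft k (antipode k y)) t =
      slL (lam k H) ((antipode k y ⊗ₜ[k] (1 : H)) * t) := by
    intro t
    induction t with
    | zero => simp
    | add x y hx hy => simp only [map_add, mul_add, hx, hy]
    | tmul x y => simp
  rw [RR_apply, h1, dagger Λ hΛ, slL_mul_left, ← RR_apply, RR_lam_Λ hΛ hε, mul_one]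

include hΛ hε in
lemma antipode_injective : Function.Injective (antipode k (A := H)) := by
  intro x y hxy
  rw [← RR_lam_mul hΛ hε x, hxy, RR_lam_mul hΛ hε]

include hΛ hε in
lemma antipode_surjective : Function.Surjective (antipode k (A := H)) :=
  LinearMap.injective_iff_surjective.mp (antipode_injective hΛ hε)

lemma RR_add (f g : H →ₗ[k] k) (x : H) : RR (f + g) x = RR f x + RR g x := by
  simp [RR_apply, slL, LinearMap.rTensor_add]

lemma RR_smul (c : k) (f : H →ₗ[k] k) (x : H) : RR (c • f) x = c • RR f x := by
  simp [RR_apply, slL, LinearMap.rTensor_smul]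

/-- `f ↦ f Λ₁ • Λ₂` -/
noncomputable def theta (Λ : H) : (H →ₗ[k] k) →ₗ[k] H where
  toFun f := RR f Λ
  map_add' f g := RR_add f g Λ
  map_smul' c f := RR_smul c f Λ

include hΛ hε in
lemma theta_injective : Function.Injective (theta (k := k) Λ) := by
  have hs : Function.Surjective (theta (k := k) Λ) := fun y => ⟨_, RR_lam_mul hΛ hε y⟩
  have hd : Module.finrank k (H →ₗ[k] k) = Module.finrank k H := Subspace.dual_finrank_eq
  exact (LinearMap.injective_iff_surjective_of_finrank_eq_finrank hd).mpr hs

include hΛ hε in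
lemma RR_lam (h : H) : RR (lam k H) h = lam k H h • (1 : H) := by
  refine eq_of_dual (k := k) fun φ => ?_
  have : φ ∘ₗ RR (lam k H) = φ 1 • lam k H := by
    apply theta_injective hΛ hε
    change RR _ Λ = RR _ Λ
    rw [RR_comp, RR_smul, RR_lam_Λ hΛ hε, RR_one]
  have := LinearMap.congr_fun this h
  simpa [mul_comm] using this

include hΛ hε in
lemma lam_Λ : lam k H Λ = 1 := by
  rw [← counit_RR, RR_lam_Λ hΛ hε]; simp

include hΛ hε in
lemma LL_lam (h : H) : LL (lam k H) h = lam k H h • LL (lam k H) Λ := by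
  refine eq_of_dual (k := k) fun φ => ?_
  have : lam k H ∘ₗ RR φ = φ (LL (lam k H) Λ) • lam k H := by
    apply theta_injective hΛ hε
    change RR _ Λ = RR _ Λ
    rw [RR_comp, RR_smul, RR_lam_Λ hΛ hε, RR_lam hΛ hε, apply_RR]
  have := LinearMap.congr_fun this h
  rw [LinearMap.comp_apply, apply_RR] at this
  simpa [mul_comm] using this

include hΛ hε in
lemma groupLike_g : IsGroupLikeElem k (LL (lam k H) Λ) where
  counit_eq_one := by
    have : Coalgebra.counit (R := k) (LL (lam k H) Λ) = lam k H Λ := by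
      rw [← apply_RR, RR_counit]
    rw [this, lam_Λ hΛ hε]
  comul_eq_tmul_self := by
    have h1 : ∀ t : H ⊗[k] H, (LL (lam k H)).lTensor H t =
        (slR (lam k H) t) ⊗ₜ[k] (LL (lam k H) Λ) := by
      intro t
      induction t with
      | zero => simp
      | add x y hx hy => simp only [map_add, hx, hy, TensorProduct.add_tmul]
      | tmul x y =>
        rw [LinearMap.lTensor_tmul, LL_lam hΛ hε, slR_tmul, TensorProduct.tmul_smul,
          TensorProduct.smul_tmul']
    rw [comul_LL, h1]
    rfl

include hΛ hε in
lemma antipode_Λ : antipode k Λ = Λ := by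
  have h1 : ∀ h : H, antipode k Λ * h = Coalgebra.counit (R := k) h • antipode k Λ := by
    intro h
    obtain ⟨x, rfl⟩ := antipode_surjective hΛ hε h
    rw [← antipode_mul_antidistrib, hΛ, map_smul, counit_antipode]
  have h2 := h1 Λ
  rw [hΛ, counit_antipode, hε, one_smul, one_smul] at h2
  exact h2.symm

include hΛ hε in
lemma Λ_mul (h : H) : Λ * h = Coalgebra.counit (R := k) h • Λ := by
  obtain ⟨x, rfl⟩ := antipode_surjective hΛ hε h
  conv_lhs => rw [← antipode_Λ hΛ hε]
  rw [← antipode_mul_antidistrib, hΛ, map_smul, counit_antipode, antipode_Λ hΛ hε]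

include hΛ hε in
lemma lam_nondeg {a : H} (ha : ∀ z, lam k H (a * z) = 0) : a = 0 := by
  obtain ⟨x, rfl⟩ := antipode_surjective hΛ hε a
  have : lam k H ∘ₗ LinearMap.mulLeft k (antipode k x) = 0 := by
    ext z; simpa using ha z
  have h2 := RR_lam_mul hΛ hε x
  rw [this] at h2
  rw [← h2]; simp [RR_apply, slL]

include hΛ hε in
lemma dual_eq (f : H →ₗ[k] k) (z : H) : f z = lam k H (antipode k (RR f Λ) * z) := by
  have : f = lam k H ∘ₗ LinearMap.mulLeft k (antipode k (RR f Λ)) := by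
    apply theta_injective hΛ hε
    change RR _ Λ = RR _ Λ
    rw [RR_lam_mul hΛ hε]
  exact LinearMap.congr_fun this z

include hΛ hε in
lemma lam_antipode (z : H) : lam k H (antipode k z) = lam k H (LL (lam k H) Λ * z) := by
  have h0 := dual_eq hΛ hε (lam k H ∘ₗ antipode k) z
  rw [LinearMap.comp_apply] at h0
  rw [h0]
  congr 2
  have h1 : ∀ t : H ⊗[k] H, antipode k (slL (lam k H ∘ₗ antipode k) t) =
      slR (lam k H) (TensorProduct.map (antipode k) (antipode k)
      (TensorProduct.comm k H H t)) := by
    intro t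
    induction t with
    | zero => simp
    | add x y hx hy => simp only [map_add, hx, hy]
    | tmul x y => simp
  rw [RR_apply, h1, ← comul_antipode, antipode_Λ hΛ hε, LL_apply]

include hΛ hε in
lemma antipode_four (x : H) :
    antipode k (antipode k (antipode k (antipode k x))) * LL (lam k H) Λ =
      LL (lam k H) Λ * x := by
  rw [← sub_eq_zero]
  apply lam_nondeg hΛ hε
  intro y
  rw [sub_mul, map_sub, sub_eq_zero, mul_assoc, mul_assoc]
  rw [← lam_cyc (LL (lam k H) Λ * y) (antipode k (antipode k x)), mul_assoc,
    ← lam_antipode hΛ hε, ← lam_antipode hΛ hε, antipode_mul_antidistrib, ← lam_cyc,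
    ← antipode_mul_antidistrib]

include hΛ hε in
lemma exists_order : ∃ N : ℕ, 0 < N ∧
    ∀ x : H, ((antipode k ∘ₗ antipode k : H →ₗ[k] H) ^ N) x = x := by
  set g := LL (lam k H) Λ with hg
  have hfin : Finite (GroupLike k H) := (linearIndep_groupLikeVal (R := k) (A := H)).finite
  let G : GroupLike k H := ⟨g, groupLike_g hΛ hε⟩
  obtain ⟨m, hm, hm1⟩ := isOfFinOrder_iff_pow_eq_one.mp (isOfFinOrder_of_finite G)
  have hgm : g ^ m = 1 := by
    have := congrArg GroupLike.val hm1
    simpa [G] using this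
  refine ⟨2 * m, by omega, fun x => ?_⟩
  have h4 : ∀ x : H, ((antipode k ∘ₗ antipode k : H →ₗ[k] H) ^ 2) x * g = g * x := by
    intro x
    rw [pow_two]
    exact antipode_four hΛ hε x
  have h5 : ∀ (j : ℕ) (x : H),
      ((antipode k ∘ₗ antipode k : H →ₗ[k] H) ^ (2 * j)) x * g ^ j = g ^ j * x := by
    intro j
    induction j with
    | zero => intro x; simp
    | succ j ih =>
      intro x
      have e : g ^ (j + 1) = g ^ j * g := pow_succ g j
      rw [e, mul_add, mul_one, pow_add, Module.End.mul_apply, ← mul_assoc, ih, mul_assoc, h4,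
        ← mul_assoc]
  have := h5 m x
  rwa [hgm, mul_one, one_mul] at this

end Integrals
end St15
namespace St15

section Positivity

lemma geom_idem {R A : Type*} [Field R] [CharZero R] [Ring A] [Algebra R A] {N : ℕ} (hN : 0 < N)
    {u : A} (hu : u ^ N = 1) :
    u * ((N : R)⁻¹ • ∑ j ∈ Finset.range N, u ^ j) = (N : R)⁻¹ • ∑ j ∈ Finset.range N, u ^ j ∧
    IsIdempotentElem ((N : R)⁻¹ • ∑ j ∈ Finset.range N, u ^ j) := by
  have h1 : u * (∑ j ∈ Finset.range N, u ^ j) = ∑ j ∈ Finset.range N, u ^ j := by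
    have := mul_geom_sum u N
    rw [hu, sub_self, sub_mul, one_mul, sub_eq_zero] at this
    exact this
  have h2 : u * ((N : R)⁻¹ • ∑ j ∈ Finset.range N, u ^ j) =
      (N : R)⁻¹ • ∑ j ∈ Finset.range N, u ^ j := by
    rw [mul_smul_comm, h1]
  refine ⟨h2, ?_⟩
  have h3 : ∀ i : ℕ, u ^ i * ((N : R)⁻¹ • ∑ j ∈ Finset.range N, u ^ j) =
      (N : R)⁻¹ • ∑ j ∈ Finset.range N, u ^ j := by
    intro i
    induction i with
    | zero => simp
    | succ i ih => rw [pow_succ, mul_assoc, h2, ih]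
  unfold IsIdempotentElem
  conv_lhs => rw [smul_mul_assoc, Finset.sum_mul]
  simp_rw [h3]
  rw [Finset.sum_const, Finset.card_range, ← Nat.cast_smul_eq_nsmul R, smul_smul,
    inv_mul_cancel₀ (Nat.cast_ne_zero.mpr hN.ne'), one_smul]

lemma trace_idem {R V : Type*} [Field R] [AddCommGroup V] [Module R V] [FiniteDimensional R V]
    {e : Module.End R V} (he : IsIdempotentElem e) :
    LinearMap.trace R V e = (Module.finrank R (LinearMap.range e) : R) := by
  have := LinearMap.IsIdempotentElem.isProj_range e he
  exact this.trace

lemma trace_root {k V : Type*} [Field k] [CharZero k] [AddCommGroup V] [Module k V]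
    [FiniteDimensional k V] {N : ℕ} (hN : 0 < N) {ζ : k} (hζ : IsPrimitiveRoot ζ N)
    {f : Module.End k V} (hf : f ^ N = 1) :
    ∃ m : ℕ → ℕ, LinearMap.trace k V f = ∑ a ∈ Finset.range N, (m a : k) * ζ ^ a ∧
      LinearMap.trace k V (f ^ (N - 1)) = ∑ a ∈ Finset.range N, (m a : k) * (ζ⁻¹) ^ a := by
  have hζ0 : ζ ≠ 0 := hζ.ne_zero hN.ne'
  let e : ℕ → Module.End k V := fun a =>
    (N : k)⁻¹ • ∑ j ∈ Finset.range N, ((ζ⁻¹) ^ a • f) ^ j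
  have hu : ∀ a : ℕ, ((ζ⁻¹) ^ a • f) ^ N = 1 := by
    intro a
    rw [smul_pow, hf, ← pow_mul, mul_comm, pow_mul, inv_pow, hζ.pow_eq_one]; simp
  have hfe : ∀ a, f * e a = ζ ^ a • e a := by
    intro a
    have := (geom_idem (R := k) hN (hu a)).1
    rw [smul_mul_assoc] at this
    change (ζ⁻¹) ^ a • (f * e a) = e a at this
    rw [← this, smul_smul, ← mul_pow, mul_inv_cancel₀ hζ0, one_pow, one_smul, this]
  have hfe' : ∀ a (j : ℕ), f ^ j * e a = (ζ ^ a) ^ j • e a := by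
    intro a j
    induction j with
    | zero => simp
    | succ j ih => rw [pow_succ, mul_assoc, hfe, mul_smul_comm, ih, smul_smul, ← pow_succ']
  have hsum : ∑ a ∈ Finset.range N, e a = 1 := by
    have h1 : ∀ j ∈ Finset.range N, ∑ a ∈ Finset.range N, ((ζ⁻¹) ^ a • f) ^ j =
        if j = 0 then (N : k) • (1 : Module.End k V) else 0 := by
      intro j hj
      have h2 : ∑ a ∈ Finset.range N, ((ζ⁻¹) ^ a • f) ^ j =
          (∑ a ∈ Finset.range N, ((ζ⁻¹) ^ j) ^ a) • f ^ j := by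
        rw [Finset.sum_smul]
        refine Finset.sum_congr rfl fun a _ => ?_
        rw [smul_pow, ← pow_mul, ← pow_mul, mul_comm]
      rw [h2]
      split_ifs with h0
      · subst h0; simp
      · have h3 := mul_geom_sum ((ζ⁻¹) ^ j) N
        have h4 : ((ζ⁻¹) ^ j) ^ N = 1 := by
          rw [← pow_mul, mul_comm, pow_mul, inv_pow, hζ.pow_eq_one]; simp
        rw [h4, sub_self, mul_eq_zero] at h3
        rcases h3 with h3 | h3
        · exfalso
          rw [sub_eq_zero] at h3
          exact hζ.inv.pow_ne_one_of_pos_of_lt h0 (Finset.mem_range.mp hj) h3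
        · rw [h3, zero_smul]
    simp only [e]
    rw [← Finset.smul_sum, Finset.sum_comm, Finset.sum_congr rfl h1, Finset.sum_ite_eq',
      if_pos (Finset.mem_range.mpr hN), smul_smul, inv_mul_cancel₀ (Nat.cast_ne_zero.mpr hN.ne'),
      one_smul]
  have key : ∀ j : ℕ, LinearMap.trace k V (f ^ j) =
      ∑ a ∈ Finset.range N, (Module.finrank k (LinearMap.range (e a)) : k) * (ζ ^ a) ^ j := by
    intro j
    conv_lhs => rw [← mul_one (f ^ j), ← hsum, Finset.mul_sum, map_sum]
    refine Finset.sum_congr rfl fun a _ => ?_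
    rw [hfe', map_smul, trace_idem (geom_idem (R := k) hN (hu a)).2, smul_eq_mul, mul_comm]
  refine ⟨fun a => Module.finrank k (LinearMap.range (e a)), ?_, ?_⟩
  · have := key 1
    simpa using this
  · rw [key]
    refine Finset.sum_congr rfl fun a _ => ?_
    congr 1
    rw [inv_pow]
    apply eq_inv_of_mul_eq_one_left
    rw [← pow_succ, Nat.sub_add_cancel hN, ← pow_mul, mul_comm, pow_mul, hζ.pow_eq_one, one_pow]

lemma positivity_lemma {k ι : Type*} [Field k] [CharZero k] [IsAlgClosed k] [Fintype ι]
    (d : ι → ℕ) (w : ∀ i, Matrix (Fin (d i)) (Fin (d i)) k) {N : ℕ} (hN : 0 < N)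
    (hw : ∀ i, w i ^ N = 1) (h0 : ∑ i, (w i).trace * (w i ^ (N - 1)).trace = 0) (i : ι) :
    (w i ^ (N - 1)).trace = 0 := by
  have : NeZero N := ⟨hN.ne'⟩
  have : NeZero (N : k) := ⟨Nat.cast_ne_zero.mpr hN.ne'⟩
  obtain ⟨ζ, hζ⟩ := HasEnoughRootsOfUnity.exists_primitiveRoot k N
  let K := algebraicClosure ℚ k
  have hζK : ζ ∈ K := by
    rw [mem_algebraicClosure_iff']
    exact IsIntegral.of_pow hN (by rw [hζ.pow_eq_one]; exact isIntegral_one)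
  let z : K := ⟨ζ, hζK⟩
  have hKalg : Algebra.IsAlgebraic ℚ K := algebraicClosure.isAlgebraic ℚ k
  let σ : K →ₐ[ℚ] ℂ := IsAlgClosed.lift
  have hz : z ^ N = 1 := Subtype.ext hζ.pow_eq_one
  have hσ : σ z⁻¹ = (starRingEnd ℂ) (σ z) := by
    have h1 : (σ z) ^ N = 1 := by rw [← map_pow, hz, map_one]
    have h2 : ‖σ z‖ = 1 := Complex.norm_eq_one_of_pow_eq_one h1 hN.ne'
    rw [map_inv₀, Complex.inv_eq_conj h2]
  have h1 : ∀ i, ∃ a b : K, (w i).trace = (a : k) ∧ (w i ^ (N - 1)).trace = (b : k) ∧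
      σ b = (starRingEnd ℂ) (σ a) := by
    intro i
    have hf : (Matrix.toLin' (w i)) ^ N = 1 := by
      rw [← Matrix.toLin'_pow, hw i, Matrix.toLin'_one]; rfl
    obtain ⟨m, hm1, hm2⟩ := trace_root hN hζ hf
    rw [← Matrix.toLin'_pow, Matrix.trace_toLin'_eq] at hm2
    rw [Matrix.trace_toLin'_eq] at hm1
    refine ⟨∑ a ∈ Finset.range N, (m a : K) * z ^ a, ∑ a ∈ Finset.range N, (m a : K) * (z⁻¹) ^ a,
      ?_, ?_, ?_⟩
    · rw [hm1]; simp [z]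
    · rw [hm2]; simp [z]
    · rw [map_sum, map_sum, map_sum]
      refine Finset.sum_congr rfl fun a _ => ?_
      rw [map_mul, map_mul, map_mul, map_pow, map_pow, map_pow, hσ]; simp
  choose a b ha hb hab using h1
  have h2 : ∑ i, a i * b i = 0 := by
    apply Subtype.ext
    rw [ZeroMemClass.coe_zero, ← h0]
    simp [ha, hb]
  have h3 := congrArg σ h2
  rw [map_sum, map_zero] at h3
  simp_rw [map_mul, hab, Complex.mul_conj] at h3
  have h4 : ∑ i, Complex.normSq (σ (a i)) = 0 := by exact_mod_cast h3
  rw [Finset.sum_eq_zero_iff_of_nonneg (fun i _ => Complex.normSq_nonneg _)] at h4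
  have h5 := Complex.normSq_eq_zero.mp (h4 i (Finset.mem_univ i))
  have h6 : σ (b i) = 0 := by rw [hab, h5, map_zero]
  have h7 : b i = 0 := (map_eq_zero σ).mp h6
  rw [hb, h7]; rfl

end Positivity
end St15
namespace St15

section MatrixPart

open Matrix

lemma trace_pi_matrix {k ι : Type*} [Field k] [Fintype ι] [DecidableEq ι]
    (d : ι → ℕ) (a b : ∀ i, Matrix (Fin (d i)) (Fin (d i)) k) :
    LinearMap.trace k _ (LinearMap.mulRight k b ∘ₗ LinearMap.mulLeft k a) =
      ∑ i, (a i).trace * (b i).trace := by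
  let B := Pi.basis (fun i => Matrix.stdBasis k (Fin (d i)) (Fin (d i)))
  rw [LinearMap.trace_eq_matrix_trace k B, Matrix.trace, Fintype.sum_sigma]
  refine Finset.sum_congr rfl fun i _ => ?_
  rw [Fintype.sum_prod_type, Matrix.trace, Matrix.trace, Finset.sum_mul_sum]
  refine Finset.sum_congr rfl fun p _ => Finset.sum_congr rfl fun q _ => ?_
  rw [Matrix.diag_apply, LinearMap.toMatrix_apply]
  have h : ((LinearMap.mulRight k b ∘ₗ LinearMap.mulLeft k a) (B ⟨i, (p, q)⟩)) i =
      a i * Matrix.single p q 1 * b i := by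
    simp [B, Pi.basis_apply, Matrix.stdBasis_eq_single]
  have h2 : ∀ x : ∀ i, Matrix (Fin (d i)) (Fin (d i)) k, B.repr x ⟨i, (p, q)⟩ = x i p q := by
    intro x
    simp only [B, Pi.basis_repr]
    rfl
  rw [h2, h, Matrix.mul_apply, Finset.sum_eq_single q]
  · simp
  · intro q' _ hq'
    rw [Matrix.mul_single_apply_of_ne _ _ _ _ _ hq', zero_mul]
  · simp

lemma matrix_lemma {k ι : Type*} [Field k] [CharZero k] [IsAlgClosed k] [Fintype ι] [DecidableEq ι]
    (d : ι → ℕ) (hd : ∀ i, NeZero (d i))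
    (θ : (∀ i, Matrix (Fin (d i)) (Fin (d i)) k) →ₗ[k] (∀ i, Matrix (Fin (d i)) (Fin (d i)) k))
    (L : (∀ i, Matrix (Fin (d i)) (Fin (d i)) k) →ₗ[k] k)
    (hL : ∀ x, L x = LinearMap.trace k _ (LinearMap.mulRight k x ∘ₗ θ))
    (hcyc : ∀ x y, L (x * y) = L (θ y * x))
    (hnd : ∀ a, (∀ z, L (a * z) = 0) → a = 0)
    (hinj : Function.Injective θ) {N : ℕ} (hN : 0 < N) (hθN : ∀ x, (θ ^ N) x = x)
    (hΛ : ∃ x, L x ≠ 0) : L 1 ≠ 0 := by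
  let A := ∀ i, Matrix (Fin (d i)) (Fin (d i)) k
  let τ : A →ₗ[k] k := ∑ i, Matrix.traceLinearMap (Fin (d i)) k k ∘ₗ LinearMap.proj i
  have hτ : ∀ x : A, τ x = ∑ i, (x i).trace := by
    intro x; simp [τ]; rfl
  have hτc : ∀ x y : A, τ (x * y) = τ (y * x) := by
    intro x y
    rw [hτ, hτ]
    exact Finset.sum_congr rfl fun i _ => Matrix.trace_mul_comm _ _
  have hsing : ∀ (a : A) (i : ι) (x : Matrix (Fin (d i)) (Fin (d i)) k),
      τ (a * (Pi.single i x : A)) = (a i * x).trace := by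
    intro a i x
    rw [hτ, Finset.sum_eq_single i]
    · change (a i * (Pi.single i x : A) i).trace = _
      rw [Pi.single_eq_same]
    · intro j _ hj
      change (a j * (Pi.single i x : A) j).trace = 0
      rw [Pi.single_eq_of_ne hj, mul_zero, Matrix.trace_zero]
    · simp
  have hτn : ∀ a b : A, (∀ x, τ (a * x) = τ (b * x)) → a = b := by
    intro a b h
    funext i
    rw [Matrix.ext_iff_trace_mul_right]
    intro x
    have h1 := h (Pi.single i x)
    rwa [hsing, hsing] at h1
  obtain ⟨w, hw⟩ : ∃ w : A, ∀ x, L x = τ (w * x) := by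
    let Φ : A →ₗ[k] (A →ₗ[k] k) := (LinearMap.mul k A).compr₂ τ
    have hΦ : Function.Injective Φ := fun a b h => hτn a b fun x => LinearMap.congr_fun h x
    have hdim : Module.finrank k A = Module.finrank k (A →ₗ[k] k) :=
      Subspace.dual_finrank_eq.symm
    obtain ⟨w, hw⟩ := (LinearMap.injective_iff_surjective_of_finrank_eq_finrank hdim).mp hΦ L
    exact ⟨w, fun x => by rw [← hw]; rfl⟩
  have hyw : ∀ y : A, w * θ y = y * w := by
    intro y
    apply hτn
    intro x
    rw [mul_assoc, ← hw, ← hcyc, hw, ← mul_assoc, hτc, mul_assoc]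
  have hreg : ∀ z : A, z * w = 0 → z = 0 := by
    intro z hz
    apply hinj
    rw [map_zero]
    apply hnd
    intro x
    rw [← hcyc, hw, ← mul_assoc, hτc, ← mul_assoc, hz, zero_mul, map_zero]
  have hinjw : Function.Injective (LinearMap.mulRight k w) := by
    rw [injective_iff_map_eq_zero]
    exact hreg
  obtain ⟨v, hv⟩ := LinearMap.injective_iff_surjective.mp hinjw 1
  replace hv : v * w = 1 := hv
  have hwv : w * v = 1 := by
    rw [← sub_eq_zero]
    apply hreg
    rw [sub_mul, mul_assoc, hv, mul_one, one_mul, sub_self]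
  have hθ : ∀ y, θ y = v * y * w := by
    intro y
    rw [mul_assoc, ← hyw, ← mul_assoc, hv, one_mul]
  have hLx : ∀ x, L x = ∑ i, (v i).trace * ((w * x) i).trace := by
    intro x
    rw [hL, ← trace_pi_matrix]
    congr 1
    refine LinearMap.ext fun z => ?_
    change θ z * x = v * z * (w * x)
    rw [hθ, mul_assoc]
  have hθj : ∀ (j : ℕ) (y : A), w ^ j * (θ ^ j) y = y * w ^ j := by
    intro j
    induction j with
    | zero => intro y; simp
    | succ j ih =>
      intro y
      have e1 : w ^ (j + 1) = w ^ j * w := pow_succ w j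
      have e2 : (θ ^ (j + 1)) y = θ ((θ ^ j) y) := by rw [pow_succ']; rfl
      rw [e1, e2, mul_assoc, hyw, ← mul_assoc, ih, mul_assoc]
  have hcomm : ∀ y : A, w ^ N * y = y * w ^ N := by
    intro y
    have := hθj N y
    rwa [hθN] at this
  have hsc : ∀ i, ∃ c : k, (w i) ^ N = c • 1 := by
    intro i
    have : (w i) ^ N ∈ Set.range (Matrix.scalar (Fin (d i))) := by
      rw [Matrix.mem_range_scalar_iff_commute_single']
      intro p q
      have := congrFun (hcomm (Pi.single i (Matrix.single p q 1))) i
      change w i ^ N * (Pi.single i (Matrix.single p q 1) : A) i =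
        (Pi.single i (Matrix.single p q 1) : A) i * w i ^ N at this
      rw [Pi.single_eq_same] at this
      exact this.symm
    obtain ⟨c, hc⟩ := this
    refine ⟨c, ?_⟩
    rw [← hc, Matrix.scalar_apply, Matrix.smul_one_eq_diagonal]
  choose c hc using hsc
  have hvi : ∀ i, v i * w i = 1 := fun i => congrFun hv i
  have hc0 : ∀ i, c i ≠ 0 := by
    intro i h
    have h1 : w i ^ N = 0 := by rw [hc, h, zero_smul]
    have h2 : (v i) ^ N * (w i) ^ N = 1 := by
      have hcm : Commute (v i) (w i) := by
        rw [Commute, SemiconjBy, hvi]; exact (congrFun hwv i).symm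
      rw [← hcm.mul_pow, hvi, one_pow]
    rw [h1, mul_zero] at h2
    have := hd i
    exact zero_ne_one h2
  have hr : ∀ i, ∃ r : k, r ^ N = c i := fun i => IsAlgClosed.exists_pow_nat_eq _ hN
  choose r hr using hr
  have hr0 : ∀ i, r i ≠ 0 := by
    intro i h
    apply hc0 i
    rw [← hr, h, zero_pow hN.ne']
  let w' : ∀ i, Matrix (Fin (d i)) (Fin (d i)) k := fun i => (r i)⁻¹ • w i
  have hw' : ∀ i, w' i ^ N = 1 := by
    intro i
    simp only [w']
    rw [smul_pow, hc, inv_pow, hr, smul_smul, inv_mul_cancel₀ (hc0 i), one_smul]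
  have hv' : ∀ i, v i = (r i)⁻¹ • (w' i) ^ (N - 1) := by
    intro i
    have h1 : v i * w' i = (r i)⁻¹ • 1 := by simp only [w']; rw [mul_smul_comm, hvi]
    have h2 : w' i * w' i ^ (N - 1) = 1 := by
      rw [← pow_succ', Nat.sub_add_cancel hN, hw']
    calc v i = v i * (w' i * w' i ^ (N - 1)) := by rw [h2, mul_one]
      _ = _ := by rw [← mul_assoc, h1, smul_mul_assoc, one_mul]
  have hw2 : ∀ i, w i = r i • w' i := by
    intro i
    simp only [w']
    rw [smul_smul, mul_inv_cancel₀ (hr0 i), one_smul]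
  clear_value w'
  intro h0
  rw [hLx, mul_one] at h0
  have h1 : ∑ i, (w' i).trace * (w' i ^ (N - 1)).trace = 0 := by
    rw [← h0]
    refine Finset.sum_congr rfl fun i _ => ?_
    have e : (w i).trace = r i * (w' i).trace := by
      conv_lhs => rw [hw2 i, Matrix.trace_smul, smul_eq_mul]
    rw [hv', e, Matrix.trace_smul, smul_eq_mul]
    have := hr0 i
    field_simp
  have h2 := positivity_lemma d w' hN hw' h1
  obtain ⟨x, hx⟩ := hΛ
  apply hx
  rw [hLx]
  refine Finset.sum_eq_zero fun i _ => ?_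
  rw [hv', Matrix.trace_smul, h2, smul_zero, zero_mul]

end MatrixPart
end St15
namespace St15

section Semisimple

open HopfAlgebra

variable {k H : Type*} [Field k] [Ring H] [HopfAlgebra k H]

variable (k H) in
include k in
lemma nontrivial_H : Nontrivial H := by
  refine ⟨1, 0, fun h => ?_⟩
  have := congrArg (Coalgebra.counit (R := k)) h
  simp at this

lemma antipode_sq_mul (x y : H) : antipode k (antipode k (x * y)) =
    antipode k (antipode k x) * antipode k (antipode k y) := by
  rw [antipode_mul_antidistrib, antipode_mul_antidistrib]

lemma slL_ext [FiniteDimensional k H] {t t' : H ⊗[k] H}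
    (h : ∀ f : H →ₗ[k] k, slL f t = slL f t') : t = t' := by
  let b := Module.finBasis k H
  have h1 : ∀ t : H ⊗[k] H, t = ∑ i, b i ⊗ₜ[k] slL (b.coord i) t := by
    intro t
    induction t with
    | zero => simp
    | add x y hx hy =>
      conv_lhs => rw [hx, hy]
      simp only [map_add, TensorProduct.tmul_add, Finset.sum_add_distrib]
    | tmul x y =>
      conv_lhs => rw [← b.sum_repr x, TensorProduct.sum_tmul]
      simp [TensorProduct.smul_tmul]
  rw [h1 t, h1 t']
  simp_rw [h]

lemma slL_comm (f : H →ₗ[k] k) (t : H ⊗[k] H) :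
    slL f (TensorProduct.comm k H H t) = slR f t := by
  induction t with
  | zero => simp
  | add x y hx hy => simp only [map_add, hx, hy]
  | tmul x y => simp

lemma slL_eq_dual (f g : H →ₗ[k] k) (t : H ⊗[k] H) :
    TensorProduct.dualDistrib k H H (f ⊗ₜ g) t = g (slL f t) := by
  induction t with
  | zero => simp
  | add x y hx hy => simp only [map_add, hx, hy]
  | tmul x y => simp

/-- `ψ x = ∑ S x₂ * x₁` -/
noncomputable def psi : H →ₗ[k] H := LinearMap.mul' k H ∘ₗ (antipode k).rTensor H ∘ₗ
  (TensorProduct.comm k H H).toLinearMap ∘ₗ Coalgebra.comul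

lemma psi_eq {ι : Type*} (x : H) (r : Coalgebra.Repr k x ι) :
    psi (k := k) x = ∑ i ∈ r.index, antipode k (r.right i) * r.left i := by
  have : psi (k := k) x = LinearMap.mul' k H ((antipode k).rTensor H
    (TensorProduct.comm k H H (Coalgebra.comul x))) := rfl
  rw [this, ← r.eq]
  simp

lemma psi_of_sq (hS : ∀ x : H, antipode k (antipode k x) = x) (x : H) :
    psi (k := k) x = Coalgebra.counit (R := k) x • (1 : H) := by
  have r := Coalgebra.Repr.arbitrary k x
  rw [psi_eq x r]
  have h1 : ∀ i, antipode k (r.right i) * r.left i =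
      antipode k (antipode k (r.left i) * r.right i) := by
    intro i
    rw [antipode_mul_antidistrib, hS]
  simp_rw [h1]
  rw [← map_sum, sum_antipode_mul_eq_smul r, map_smul, antipode_one]

variable [FiniteDimensional k H]

lemma pIdem_apply (f : H →ₗ[k] k) :
    f (pIdem k H) = (Module.finrank k H : k)⁻¹ * LinearMap.trace k H (RR f) := by
  rw [pIdem, map_smul, Module.apply_evalEquiv_symm_apply, smul_eq_mul]
  congr 1
  rw [LinearMap.comp_apply, ← LinearMap.trace_transpose' (RR f)]
  congr 1
  refine LinearMap.ext fun g => LinearMap.ext fun h => ?_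
  exact slL_eq_dual f g (Coalgebra.comul h)

lemma trace_RR_mul (f : H →ₗ[k] k) (x : H) :
    LinearMap.trace k H (RR (f ∘ₗ LinearMap.mulRight k x)) =
      LinearMap.trace k H (RR f ∘ₗ LinearMap.mulRight k (psi (k := k) x)) := by
  have r := Coalgebra.Repr.arbitrary k x
  have h0 : ∀ t : H ⊗[k] H, slL (f ∘ₗ LinearMap.mulRight k x) t =
      slL f (t * (x ⊗ₜ[k] (1 : H))) := by
    intro t
    induction t with
    | zero => simp
    | add x y hx hy => simp only [map_add, add_mul, hx, hy]
    | tmul x y => simp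
  have h1 : RR (f ∘ₗ LinearMap.mulRight k x) = ∑ i ∈ r.index,
      LinearMap.mulRight k (antipode k (r.right i)) * (RR f * LinearMap.mulRight k (r.left i)) := by
    refine LinearMap.ext fun z => ?_
    rw [RR_apply, h0, ← sum_D2 x r, Finset.mul_sum, map_sum, LinearMap.sum_apply]
    refine Finset.sum_congr rfl fun i _ => ?_
    rw [← mul_assoc, ← Bialgebra.comul_mul, slL_mul_right]
    rfl
  have h2 : RR f ∘ₗ LinearMap.mulRight k (psi (k := k) x) = ∑ i ∈ r.index,
      RR f * LinearMap.mulRight k (r.left i) * LinearMap.mulRight k (antipode k (r.right i)) := by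
    refine LinearMap.ext fun z => ?_
    rw [psi_eq x r, LinearMap.sum_apply, LinearMap.comp_apply, LinearMap.mulRight_apply,
      Finset.mul_sum, map_sum]
    refine Finset.sum_congr rfl fun i _ => ?_
    rw [← mul_assoc]
    rfl
  rw [h1, h2, map_sum, map_sum]
  exact Finset.sum_congr rfl fun i _ => LinearMap.trace_mul_comm k _ _

lemma pIdem_mul_apply (f : H →ₗ[k] k) (x : H) :
    f (pIdem k H * x) = (Module.finrank k H : k)⁻¹ *
      LinearMap.trace k H (RR f ∘ₗ LinearMap.mulRight k (psi (k := k) x)) := by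
  rw [← trace_RR_mul, ← pIdem_apply]; rfl

variable [CharZero k]

lemma counit_pIdem : Coalgebra.counit (R := k) (pIdem k H) = 1 := by
  have := nontrivial_H k H
  rw [pIdem_apply]
  have : RR (Coalgebra.counit (R := k) (A := H)) = LinearMap.id := LinearMap.ext RR_counit
  rw [this, LinearMap.trace_id, inv_mul_cancel₀]
  exact Nat.cast_ne_zero.mpr Module.finrank_pos.ne'

lemma psi_pIdem : psi (k := k) (pIdem k H) = 1 := by
  have h : TensorProduct.comm k H H (Coalgebra.comul (pIdem k H)) =
      Coalgebra.comul (R := k) (pIdem k H) := by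
    apply slL_ext
    intro f
    rw [slL_comm]
    refine eq_of_dual (k := k) fun g => ?_
    rw [← apply_slL, ← RR_apply, ← RR_apply]
    change (f ∘ₗ RR g) _ = (g ∘ₗ RR f) _
    rw [pIdem_apply, pIdem_apply]
    have e : ∀ f g : H →ₗ[k] k, RR (f ∘ₗ RR g) = RR f * RR g :=
      fun f g => LinearMap.ext fun x => RR_comp g f x
    rw [e, e, LinearMap.trace_mul_comm]
  have : psi (k := k) (pIdem k H) = LinearMap.mul' k H ((antipode k).rTensor H
    (TensorProduct.comm k H H (Coalgebra.comul (pIdem k H)))) := rfl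
  rw [this, h, mul_antipode_rTensor_comul_apply, counit_pIdem, map_one]

lemma pIdem_sq : pIdem k H * pIdem k H = pIdem k H := by
  refine eq_of_dual (k := k) fun f => ?_
  rw [pIdem_mul_apply, psi_pIdem, pIdem_apply]
  congr 2
  ext z
  simp

lemma trace_cube {V : Type*} [AddCommGroup V] [Module k V] [FiniteDimensional k V]
    {T : Module.End k V} (hT : T * T * T = T) : ∃ m : ℤ, LinearMap.trace k V T = m := by
  have h4 : T * T * (T * T) = T * T := by rw [← mul_assoc, hT]
  have h3 : T * (T * T) = T := by rw [← mul_assoc, hT]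
  have e1 : IsIdempotentElem ((2 : k)⁻¹ • (T * T + T)) := by
    unfold IsIdempotentElem
    rw [smul_mul_smul_comm]
    have : (T * T + T) * (T * T + T) = (2 : k) • (T * T + T) := by
      rw [mul_add, add_mul, add_mul, h4, h3, hT, two_smul]; abel
    rw [this, smul_smul]; norm_num
  have e2 : IsIdempotentElem ((2 : k)⁻¹ • (T * T - T)) := by
    unfold IsIdempotentElem
    rw [smul_mul_smul_comm]
    have : (T * T - T) * (T * T - T) = (2 : k) • (T * T - T) := by
      rw [mul_sub, sub_mul, sub_mul, h4, h3, hT, two_smul]; abel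
    rw [this, smul_smul]; norm_num
  have h5 : T = (2 : k)⁻¹ • (T * T + T) - (2 : k)⁻¹ • (T * T - T) := by
    rw [← smul_sub, add_sub_sub_cancel, ← two_smul k T, smul_smul]; norm_num
  refine ⟨(Module.finrank k (LinearMap.range ((2 : k)⁻¹ • (T * T + T))) : ℤ) -
    (Module.finrank k (LinearMap.range ((2 : k)⁻¹ • (T * T - T))) : ℤ), ?_⟩
  conv_lhs => rw [h5, map_sub, trace_idem e1, trace_idem e2]
  push_cast
  rfl

lemma invol_eq_one {V : Type*} [AddCommGroup V] [Module k V] [FiniteDimensional k V]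
    {T : Module.End k V} (hT : T * T = 1) {v : V} (hv : v ≠ 0) (hTv : T v = v)
    (h0 : LinearMap.trace k V T ≠ 0) {m : ℤ}
    (hm : LinearMap.trace k V T = (Module.finrank k V : k) * m) : T = 1 := by
  have e1 : IsIdempotentElem ((2 : k)⁻¹ • (1 + T)) := by
    unfold IsIdempotentElem
    rw [smul_mul_smul_comm]
    have : (1 + T) * (1 + T) = (2 : k) • (1 + T) := by
      rw [mul_add, add_mul, add_mul, hT, one_mul, one_mul, mul_one, two_smul]; abel
    rw [this, smul_smul]; norm_num
  have e2 : IsIdempotentElem ((2 : k)⁻¹ • (1 - T)) := by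
    unfold IsIdempotentElem
    rw [smul_mul_smul_comm]
    have : (1 - T) * (1 - T) = (2 : k) • (1 - T) := by
      rw [mul_sub, sub_mul, sub_mul, hT, one_mul, one_mul, mul_one, two_smul]; abel
    rw [this, smul_smul]; norm_num
  have t1 := trace_idem e1
  have t2 := trace_idem e2
  set a := Module.finrank k (LinearMap.range ((2 : k)⁻¹ • (1 + T))) with ha
  set b := Module.finrank k (LinearMap.range ((2 : k)⁻¹ • (1 - T))) with hb
  rw [map_smul, map_add, LinearMap.trace_one, smul_eq_mul] at t1
  rw [map_smul, map_sub, LinearMap.trace_one, smul_eq_mul] at t2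
  have s1 : (Module.finrank k V : k) = a + b := by rw [← t1, ← t2]; ring
  have s2 : LinearMap.trace k V T = a - b := by rw [← t1, ← t2]; ring
  have s1' : Module.finrank k V = a + b := by exact_mod_cast s1
  have s3 : (a : ℤ) - b = (a + b) * m := by
    rw [s2, s1] at hm
    exact_mod_cast hm
  have s4 : (a : ℤ) - b ≠ 0 := by
    rw [s2] at h0
    exact_mod_cast h0
  have ha1 : 1 ≤ a := by
    rw [Nat.one_le_iff_ne_zero, ha, Ne, Submodule.finrank_eq_zero, LinearMap.range_eq_bot]
    intro h
    have := LinearMap.congr_fun h v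
    simp only [LinearMap.smul_apply, LinearMap.add_apply, Module.End.one_apply, hTv,
      LinearMap.zero_apply] at this
    rw [← two_smul k v, smul_smul] at this
    norm_num at this
    exact hv this
  have hb0 : b = 0 := by
    by_contra hb1
    have hb2 : 1 ≤ b := Nat.one_le_iff_ne_zero.mpr hb1
    rcases lt_trichotomy m 0 with h | h | h
    · nlinarith
    · rw [h, mul_zero] at s3; exact s4 s3
    · nlinarith
  rw [hb, Submodule.finrank_eq_zero, LinearMap.range_eq_bot] at hb0
  rw [smul_eq_zero] at hb0
  rcases hb0 with h | h
  · norm_num at h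
  · exact (sub_eq_zero.mp h).symm

variable {Λ : H} (hΛ : ∀ h : H, h * Λ = Coalgebra.counit (R := k) h • Λ)
  (hε : Coalgebra.counit (R := k) Λ = 1)

include hΛ hε in
lemma lam_one_ne [IsAlgClosed k] [IsSemisimpleRing H] : lam k H 1 ≠ 0 := by
  obtain ⟨n, d, hd, ⟨e⟩⟩ := IsSemisimpleRing.exists_algEquiv_pi_matrix_of_isAlgClosed k H
  obtain ⟨N, hN, hSN⟩ := exists_order hΛ hε
  let θ := e.toLinearEquiv.conj (antipode k ∘ₗ antipode k)
  have hθ : ∀ x, θ x = e (antipode k (antipode k (e.symm x))) := fun x => rfl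
  have hθj : ∀ (j : ℕ) x, (θ ^ j) x =
      e (((antipode k ∘ₗ antipode k : H →ₗ[k] H) ^ j) (e.symm x)) := by
    intro j
    induction j with
    | zero => intro x; simp
    | succ j ih =>
      intro x
      rw [pow_succ, pow_succ, Module.End.mul_apply, Module.End.mul_apply, ih, hθ, e.symm_apply_apply]
      rfl
  let L := lam k H ∘ₗ e.symm.toLinearMap
  have hLa : ∀ x, L x = lam k H (e.symm x) := fun x => rfl
  have := matrix_lemma d hd θ L ?_ ?_ ?_ ?_ hN ?_ ?_
  · rwa [hLa, map_one] at this
  · intro x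
    rw [hLa, lam_apply, ← LinearMap.trace_conj' _ e.toLinearEquiv]
    congr 1
    refine LinearMap.ext fun z => ?_
    change e (antipode k (antipode k (e.symm z)) * e.symm x) = e (antipode k (antipode k (e.symm z))) * x
    rw [map_mul, e.apply_symm_apply]
  · intro x y
    rw [hLa, hLa, map_mul e.symm, map_mul e.symm, hθ, e.symm_apply_apply, lam_cyc]
  · intro a ha
    have h1 : e.symm a = 0 := by
      apply lam_nondeg hΛ hε
      intro z
      have := ha (e z)
      rwa [hLa, map_mul, e.symm_apply_apply] at this
    exact (map_eq_zero_iff _ e.symm.injective).mp h1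
  · intro x y hxy
    rw [hθ, hθ] at hxy
    exact e.symm.injective (antipode_injective hΛ hε (antipode_injective hΛ hε (e.injective hxy)))
  · intro x
    rw [hθj, hSN, e.apply_symm_apply]
  · refine ⟨e Λ, ?_⟩
    rw [hLa, e.symm_apply_apply, lam_Λ hΛ hε]
    exact one_ne_zero

include hΛ hε in
lemma antipode_sq [IsAlgClosed k] [IsSemisimpleRing H] (x : H) : antipode k (antipode k x) = x := by
  have hnt := nontrivial_H k H
  have hn : (Module.finrank k H : k) ≠ 0 := Nat.cast_ne_zero.mpr Module.finrank_pos.ne'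
  have h1 := lam_one_ne hΛ hε
  have hg : LL (lam k H) Λ = 1 := by
    have := LL_lam hΛ hε 1
    rw [LL_apply, Bialgebra.comul_one, Algebra.TensorProduct.one_def, slR_tmul] at this
    exact (smul_right_injective H h1 this).symm
  have h4 : ∀ x : H, antipode k (antipode k (antipode k (antipode k x))) = x := by
    intro x
    have := antipode_four hΛ hε x
    rwa [hg, mul_one, one_mul] at this
  have hSp : antipode k (antipode k (pIdem k H)) = pIdem k H := by
    refine eq_of_dual (k := k) fun f => ?_
    let T : Module.End k H := antipode k ∘ₗ antipode k
    have hT : T * T = 1 := LinearMap.ext h4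
    change (f ∘ₗ T) _ = _
    rw [pIdem_apply, pIdem_apply]
    congr 1
    have hc : ∀ t : H ⊗[k] H, slL f (TensorProduct.map (antipode k) (antipode k)
        (TensorProduct.comm k H H (TensorProduct.map (antipode k) (antipode k)
        (TensorProduct.comm k H H t)))) = T (slL (f ∘ₗ T) t) := by
      intro t
      induction t with
      | zero => simp
      | add x y hx hy => simp only [map_add, hx, hy]
      | tmul x y => simp [T]
    have h5 : RR f * T = T * RR (f ∘ₗ T) := by
      refine LinearMap.ext fun z => ?_
      change RR f (antipode k (antipode k z)) = _
      rw [RR_apply, comul_antipode, comul_antipode, hc]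
      rfl
    have h6 : RR (f ∘ₗ T) = T * (RR f * T) := by
      rw [h5, ← mul_assoc, hT, one_mul]
    rw [h6, LinearMap.trace_mul_comm, mul_assoc, hT, mul_one]
  have hlp : lam k H (pIdem k H) = (Module.finrank k H : k)⁻¹ * lam k H 1 := by
    rw [pIdem_apply]
    congr 1
    have : RR (lam k H) = (lam k H).smulRight (1 : H) := LinearMap.ext (RR_lam hΛ hε)
    rw [this, LinearMap.trace_smulRight]
  have hE : ∃ m : ℤ, lam k H (pIdem k H) = m := by
    rw [lam_apply]
    apply trace_cube
    refine LinearMap.ext fun z => ?_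
    simp only [Module.End.mul_apply, LinearMap.comp_apply, LinearMap.mulRight_apply,
      antipode_sq_mul, hSp, h4, mul_assoc, pIdem_sq]
  obtain ⟨m, hm⟩ := hE
  have hl1 : lam k H 1 = LinearMap.trace k H (antipode k ∘ₗ antipode k) := by
    rw [lam_apply, LinearMap.mulRight_one, LinearMap.id_comp]
  have hT1 := invol_eq_one (k := k) (T := (antipode k ∘ₗ antipode k : H →ₗ[k] H)) (m := m)
    (LinearMap.ext h4) (v := (1 : H)) one_ne_zero (by simp) (by rwa [← hl1])
    (by rw [← hl1, ← hm, hlp, mul_inv_cancel_left₀ hn])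
  exact LinearMap.congr_fun hT1 x

end Semisimple
end St15
namespace St15

section Final

open HopfAlgebra

lemma exists_integral {k Q : Type*} [Field k] [Ring Q] [HopfAlgebra k Q] [IsSemisimpleRing Q] :
    ∃ Λ : Q, (∀ h : Q, h * Λ = Coalgebra.counit (R := k) h • Λ) ∧
      Coalgebra.counit (R := k) Λ = 1 := by
  let I₀ : Ideal Q := RingHom.ker (Bialgebra.counitAlgHom k Q)
  have hI₀ : ∀ x : Q, x ∈ I₀ ↔ Coalgebra.counit (R := k) x = 0 := fun x => Iff.rfl
  obtain ⟨I, hI⟩ := exists_isCompl I₀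
  have h1 : (1 : Q) ∈ I₀ ⊔ I := by rw [hI.sup_eq_top]; trivial
  obtain ⟨a, ha, Λ, hΛ, haΛ⟩ := Submodule.mem_sup.mp h1
  have hε : Coalgebra.counit (R := k) Λ = 1 := by
    have := congrArg (Coalgebra.counit (R := k)) haΛ
    rwa [map_add, (hI₀ a).mp ha, zero_add, Bialgebra.counit_one] at this
  refine ⟨Λ, fun h => ?_, hε⟩
  rw [← sub_eq_zero]
  have h2 : h * Λ - Coalgebra.counit (R := k) h • Λ ∈ I₀ ⊓ I := by
    refine ⟨?_, ?_⟩
    · change _ ∈ I₀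
      rw [hI₀, map_sub, Bialgebra.counit_mul, map_smul, smul_eq_mul, sub_self]
    · have : h * Λ - Coalgebra.counit (R := k) h • Λ =
          (h - algebraMap k Q (Coalgebra.counit (R := k) h)) * Λ := by
        rw [sub_mul, Algebra.smul_def]
      rw [this]
      exact I.mul_mem_left _ hΛ
  rw [hI.inf_eq_bot] at h2
  exact h2

variable {k H Q : Type*} [Field k]
    [Ring H] [HopfAlgebra k H] [Ring Q] [HopfAlgebra k Q]
    (π : H →ₐc[k] Q)

lemma map_comul (x : H) : TensorProduct.map (π : H →ₗ[k] Q) (π : H →ₗ[k] Q)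
    (Coalgebra.comul (R := k) x) = Coalgebra.comul (R := k) (π x) :=
  CoalgHomClass.map_comp_comul_apply π x

lemma map_counit (x : H) : Coalgebra.counit (R := k) (π x) = Coalgebra.counit (R := k) x :=
  CoalgHomClass.counit_comp_apply π x

open WithConv in
lemma map_antipode (h : H) : π (antipode k h) = antipode k (π h) := by
  have key : toConv ((π : H →ₗ[k] Q) ∘ₗ antipode k) =
      toConv (antipode k ∘ₗ (π : H →ₗ[k] Q)) := by
    apply left_inv_eq_right_inv (a := toConv (π : H →ₗ[k] Q))
    · ext c
      change LinearMap.mul' k Q (TensorProduct.map ((π : H →ₗ[k] Q) ∘ₗ antipode k)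
        (π : H →ₗ[k] Q) (Coalgebra.comul c)) = algebraMap k Q (Coalgebra.counit c)
      have h1 : ∀ t : H ⊗[k] H, LinearMap.mul' k Q (TensorProduct.map
          ((π : H →ₗ[k] Q) ∘ₗ antipode k) (π : H →ₗ[k] Q) t) =
          π (LinearMap.mul' k H ((antipode k).rTensor H t)) := by
        intro t
        induction t with
        | zero => simp
        | add x y hx hy => simp only [map_add, hx, hy]
        | tmul x y => simp
      rw [h1, mul_antipode_rTensor_comul_apply]
      exact AlgHomClass.commutes π _
    · ext c
      change LinearMap.mul' k Q (TensorProduct.map (π : H →ₗ[k] Q)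
        (antipode k ∘ₗ (π : H →ₗ[k] Q)) (Coalgebra.comul c)) = algebraMap k Q (Coalgebra.counit c)
      have h1 : ∀ t : H ⊗[k] H, LinearMap.mul' k Q (TensorProduct.map
          (π : H →ₗ[k] Q) (antipode k ∘ₗ (π : H →ₗ[k] Q)) t) =
          LinearMap.mul' k Q ((antipode k).lTensor Q (TensorProduct.map
          (π : H →ₗ[k] Q) (π : H →ₗ[k] Q) t)) := by
        intro t
        induction t with
        | zero => simp
        | add x y hx hy => simp only [map_add, hx, hy]
        | tmul x y => simp
      rw [h1, map_comul, mul_antipode_lTensor_comul_apply, map_counit]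
  exact congrArg (fun z => z.ofConv h) key

lemma map_psi (x : H) : π (psi (k := k) x) = psi (k := k) (π x) := by
  have h0 : psi (k := k) (π x) = LinearMap.mul' k Q ((antipode k).rTensor Q
    (TensorProduct.comm k Q Q (Coalgebra.comul (π x)))) := rfl
  have h1 : psi (k := k) x = LinearMap.mul' k H ((antipode k).rTensor H
    (TensorProduct.comm k H H (Coalgebra.comul x))) := rfl
  rw [h0, h1, ← map_comul]
  generalize (Coalgebra.comul (R := k) x) = t
  induction t with
  | zero => simp
  | add x y hx hy => simp only [map_add, hx, hy]
  | tmul x y => simp [map_antipode]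

lemma map_RR (f : Q →ₗ[k] k) (x : H) : π (RR (f ∘ₗ (π : H →ₗ[k] Q)) x) = RR f (π x) := by
  rw [RR_apply, RR_apply, ← map_comul]
  generalize (Coalgebra.comul (R := k) x) = t
  induction t with
  | zero => simp
  | add x y hx hy => simp only [map_add, hx, hy]
  | tmul x y => simp

lemma RR_mul {ι : Type*} [Fintype ι] (b : Module.Basis ι k Q) (f : Q →ₗ[k] k) (x y : H) :
    RR (f ∘ₗ (π : H →ₗ[k] Q)) (x * y) = ∑ i, RR (b.coord i ∘ₗ (π : H →ₗ[k] Q)) x *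
      RR ((f ∘ₗ LinearMap.mulLeft k (b i)) ∘ₗ (π : H →ₗ[k] Q)) y := by
  simp only [RR_apply, Bialgebra.comul_mul]
  generalize (Coalgebra.comul (R := k) x) = s
  generalize (Coalgebra.comul (R := k) y) = t
  induction s with
  | zero => simp
  | add x y hx hy => simp only [map_add, add_mul, Finset.sum_add_distrib, hx, hy]
  | tmul x y =>
    induction t with
    | zero => simp
    | add x y hx hy => simp only [map_add, mul_add, Finset.sum_add_distrib, hx, hy]
    | tmul z w =>
      have hx : f (π x * π z) = ∑ i, b.coord i (π x) * f (b i * π z) := by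
        conv_lhs => rw [← b.sum_repr (π x), Finset.sum_mul, map_sum]
        simp
      simp only [Algebra.TensorProduct.tmul_mul_tmul, slL_tmul, LinearMap.comp_apply,
        LinearMap.mulLeft_apply, smul_mul_smul_comm]
      rw [← Finset.sum_smul]
      congr 1
      have e : (π : H →ₗ[k] Q) (x * z) = π x * π z := map_mul π x z
      rw [e, hx]
      rfl

variable [FiniteDimensional k H] [FiniteDimensional k Q]

lemma trace_RR_rad (hker : ∀ h : H, π h = 0 ↔ h ∈ Ideal.jacobson (⊥ : Ideal H))
    (f : Q →ₗ[k] k) (j : H) (hj : π j = 0) :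
    LinearMap.trace k H (RR (f ∘ₗ (π : H →ₗ[k] Q)) ∘ₗ LinearMap.mulRight k j) = 0 := by
  set J : Ideal H := Ideal.jacobson (⊥ : Ideal H) with hJ
  have hp0 : ∀ y : H, y ∈ J ^ 0 := fun y => by
    have h0 : J ^ 0 = ⊤ := by simp
    rw [h0]; trivial
  have hps : ∀ i : ℕ, J ^ (i + 1) = J ^ i * J := fun i => Submodule.pow_succ J
  have hpres : ∀ (i : ℕ) (f : Q →ₗ[k] k) (x : H), x ∈ J ^ i →
      RR (f ∘ₗ (π : H →ₗ[k] Q)) x ∈ J ^ i := by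
    intro i
    induction i with
    | zero => intro f x _; exact hp0 _
    | succ i ih =>
      intro f x hx
      rw [hps] at hx ⊢
      refine Submodule.smul_induction_on hx ?_ ?_
      · intro a ha c hc
        rw [smul_eq_mul, RR_mul π (Module.finBasis k Q)]
        refine Ideal.sum_mem _ fun l _ => Ideal.mul_mem_mul (ih _ _ ha) ?_
        rw [← hker, map_RR, (hker c).mpr hc, map_zero]
      · intro a c ha hc
        rw [map_add]
        exact Ideal.add_mem _ ha hc
  have hart : IsArtinianRing H := IsArtinianRing.of_finite k H
  obtain ⟨m, hm⟩ := IsArtinianRing.isNilpotent_jacobson_bot (R := H)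
  set T : Module.End k H := RR (f ∘ₗ (π : H →ₗ[k] Q)) ∘ₗ LinearMap.mulRight k j with hT
  have hTi : ∀ (i : ℕ) (x : H), (T ^ i) x ∈ J ^ i := by
    intro i
    induction i with
    | zero => intro x; exact hp0 _
    | succ i ih =>
      intro x
      rw [pow_succ', Module.End.mul_apply]
      apply hpres
      rw [hps]
      exact Ideal.mul_mem_mul (ih x) ((hker j).mp hj)
  have hTm : IsNilpotent T := by
    refine ⟨m, LinearMap.ext fun x => ?_⟩
    have := hTi m x
    rw [hJ, hm] at this
    exact this
  exact (LinearMap.isNilpotent_trace_of_isNilpotent hTm).eq_zero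

variable [CharZero k] [IsAlgClosed k]

lemma semisimple_Q (hsurj : Function.Surjective π)
    (hker : ∀ h : H, π h = 0 ↔ h ∈ Ideal.jacobson (⊥ : Ideal H)) : IsSemisimpleRing Q := by
  have hart : IsArtinianRing H := IsArtinianRing.of_finite k H
  have h1 : IsSemisimpleRing (H ⧸ Ring.jacobson H) := inferInstance
  let φ : H ⧸ Ring.jacobson H →+* Q := Ideal.Quotient.lift (Ring.jacobson H) (π : H →+* Q) (by
    intro a ha
    rw [← Ideal.jacobson_bot] at ha
    exact (hker a).mpr ha)
  have hφ : Function.Surjective φ := by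
    intro q
    obtain ⟨h, rfl⟩ := hsurj q
    exact ⟨Ideal.Quotient.mk _ h, rfl⟩
  exact φ.isSemisimpleRing_of_surjective hφ

lemma right_integral (hsurj : Function.Surjective π)
    (hker : ∀ h : H, π h = 0 ↔ h ∈ Ideal.jacobson (⊥ : Ideal H))
    (hS : ∀ x : Q, antipode k (antipode k x) = x) (q : Q) :
    π (pIdem k H) * q = Coalgebra.counit (R := k) q • π (pIdem k H) := by
  obtain ⟨x, rfl⟩ := hsurj q
  refine eq_of_dual (k := k) fun f => ?_
  have h1 := pIdem_mul_apply (f ∘ₗ (π : H →ₗ[k] Q)) x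
  have h2 := pIdem_apply (f ∘ₗ (π : H →ₗ[k] Q))
  have e1 : (f ∘ₗ (π : H →ₗ[k] Q)) (pIdem k H * x) = f (π (pIdem k H) * π x) := by
    rw [← map_mul]; rfl
  have e2 : (f ∘ₗ (π : H →ₗ[k] Q)) (pIdem k H) = f (π (pIdem k H)) := rfl
  rw [e1] at h1
  rw [e2] at h2
  rw [map_smul, smul_eq_mul, h1, h2, mul_left_comm]
  congr 1
  have hj : π (psi (k := k) x - Coalgebra.counit (R := k) (π x) • (1 : H)) = 0 := by
    rw [map_sub, map_psi, psi_of_sq hS, map_smul, map_one, sub_self]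
  have h3 := trace_RR_rad π hker f _ hj
  have h4 : RR (f ∘ₗ (π : H →ₗ[k] Q)) ∘ₗ LinearMap.mulRight k
      (psi (k := k) x - Coalgebra.counit (R := k) (π x) • (1 : H)) =
      RR (f ∘ₗ (π : H →ₗ[k] Q)) ∘ₗ LinearMap.mulRight k (psi (k := k) x) -
      Coalgebra.counit (R := k) (π x) • RR (f ∘ₗ (π : H →ₗ[k] Q)) := by
    refine LinearMap.ext fun z => ?_
    simp [mul_sub]
  rw [h4, map_sub, sub_eq_zero, map_smul, smul_eq_mul] at h3
  exact h3

lemma right_integral_Q (hS : ∀ x : Q, antipode k (antipode k x) = x) (q : Q) :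
    pIdem k Q * q = Coalgebra.counit (R := k) q • pIdem k Q := by
  refine eq_of_dual (k := k) fun f => ?_
  rw [pIdem_mul_apply, psi_of_sq hS, map_smul, pIdem_apply, smul_eq_mul, mul_left_comm]
  congr 1
  rw [← smul_eq_mul, ← map_smul]
  congr 1
  refine LinearMap.ext fun z => ?_
  simp

end Final
end St15

/-- Let `H` be a finite-dimensional Hopf algebra over a field `k` of
characteristic zero with the Chevalley property, i.e. the Jacobson radical `J` of `H`
is a Hopf ideal, so that there is a quotient Hopf algebra map `π : H → H/J` (modelled
by a surjective bialgebra homomorphism `π : H →ₐc[k] Q` whose kernel is the Jacobson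
radical of `H`).  Then `π(p_H) = p_{H/J}`, where `p_H = (1/dim H) χ_{H*}` and
`p_{H/J} = (1/dim(H/J)) χ_{(H/J)*}`; in particular `π(p_H)` is the Haar integral of the
semisimple Hopf algebra `H/J` (a two-sided integral with `ε(π(p_H)) = 1`). -/
theorem stmt15 {k H Q : Type*} [Field k] [CharZero k] [IsAlgClosed k]
    [Ring H] [HopfAlgebra k H] [FiniteDimensional k H]
    [Ring Q] [HopfAlgebra k Q] [FiniteDimensional k Q]
    (π : H →ₐc[k] Q) (hsurj : Function.Surjective π)
    (hker : ∀ h : H, π h = 0 ↔ h ∈ Ideal.jacobson (⊥ : Ideal H)) :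
    π (pIdem k H) = pIdem k Q ∧
      (∀ q : Q, q * π (pIdem k H) = Coalgebra.counit (R := k) q • π (pIdem k H)) ∧
      (∀ q : Q, π (pIdem k H) * q = Coalgebra.counit (R := k) q • π (pIdem k H)) ∧
      Coalgebra.counit (R := k) (π (pIdem k H)) = 1 := by
  have hss := St15.semisimple_Q π hsurj hker
  obtain ⟨Λ, hΛ, hε⟩ := St15.exists_integral (k := k) (Q := Q)
  have hS := St15.antipode_sq (k := k) hΛ hε
  have huniq : ∀ e : Q, (∀ q : Q, e * q = Coalgebra.counit (R := k) q • e) →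
      Coalgebra.counit (R := k) e = 1 → e = Λ := by
    intro e he he1
    have h1 := he Λ
    rw [hΛ, he1, hε, one_smul, one_smul] at h1
    exact h1.symm
  have hπε : Coalgebra.counit (R := k) (π (pIdem k H)) = 1 := by
    rw [St15.map_counit, St15.counit_pIdem]
  have h1 := St15.right_integral π hsurj hker hS
  have e1 := huniq _ h1 hπε
  have e2 := huniq _ (St15.right_integral_Q hS) St15.counit_pIdem
  refine ⟨by rw [e1, e2], ?_, h1, hπε⟩
  rw [e1]
  exact hΛ
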